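/- In local coordinates, the higher Roytenberg bracket of two coordinate p-forms is [dy^I, dy^J]_R = R^{IJm} ∂_m + S^{IJ}{}_L dy^L, with structure functions R^{IJm} = Π^{nI} ∂_n Π^{mJ} − Π^{nJ} ∂_n Π^{mI} − Σ_{r=1}^{p} (∂_k Π^{j_r I}) Π^{m j₁…k…j_p} + Π^{kI} Π^{lJ} Π^{mL} H_{klL} and S^{IJ}{}_L = −Σ_{r=1}^{p} (∂_k Π^{j_r I}) δ^{j₁…k…j_p}_L + Π^{kI} Π^{lJ} H_{klL}, where in the sums over r the index k replaces j_r in the multi-index (j₁,…,j_p) of J's counterpart, and summation over repeated indices is understood. -/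

import Mathlib

/-!
We formalize the differential geometry over the model space `ℝⁿ` with its global
coordinates.  A differential `p`-form is represented by its fully antisymmetric,
smooth component array `Tens n p`, a `p`-vector field likewise by its
(contravariant) component array, and a vector field by its components.
Throughout, writing `p = q + 1` encodes the hypothesis `p ≥ 1`.
-/

open scoped BigOperators

noncomputable section

/-- Points of the model space `ℝⁿ`. -/
abbrev Pt (n : ℕ) := Fin n → ℝ

/-- Partial derivative along the `j`-th coordinate direction. -/
def pd {n : ℕ} (j : Fin n) (f : Pt n → ℝ) (x : Pt n) : ℝ :=
  fderiv ℝ f x (Pi.single j 1)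

/-- Vector fields on `ℝⁿ` (in components). -/
abbrev VF (n : ℕ) := Pt n → Pt n

/-- Degree-`p` component arrays (covariant for differential forms,
contravariant for multivector fields). -/
abbrev Tens (n p : ℕ) := Pt n → (Fin p → Fin n) → ℝ

/-- All components are smooth functions. -/
def SmoothT {n p : ℕ} (T : Tens n p) : Prop :=
  ∀ a, ContDiff ℝ (⊤ : ℕ∞) fun x => T x a

/-- The component array is fully antisymmetric. -/
def AltT {n p : ℕ} (T : Tens n p) : Prop :=
  ∀ (x : Pt n) (a : Fin p → Fin n) (σ : Equiv.Perm (Fin p)),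
    T x (a ∘ σ) = ((Equiv.Perm.sign σ : ℤ) : ℝ) * T x a

/-- Lie bracket of vector fields: `[V,W] = (V·∇)W − (W·∇)V`. -/
def lieB {n : ℕ} (V W : VF n) : VF n :=
  fun x => fderiv ℝ W x (V x) - fderiv ℝ V x (W x)

/-- Interior product `i_V ω` of a vector field with a `(p+1)`-form. -/
def iV {n p : ℕ} (V : VF n) (ω : Tens n (p + 1)) : Tens n p :=
  fun x a => ∑ j, V x j * ω x (Fin.cons j a)

/-- Exterior derivative of a `p`-form:
`(dω)_{a₀…a_p} = ∑ᵢ (−1)ⁱ ∂_{aᵢ} ω_{a₀…âᵢ…a_p}`. -/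
def dT {n p : ℕ} (ω : Tens n p) : Tens n (p + 1) :=
  fun x a => ∑ i : Fin (p + 1),
    (-1 : ℝ) ^ (i : ℕ) * pd (a i) (fun y => ω y (i.removeNth a)) x

/-- Lie derivative of a `p`-form along a vector field:
`(L_V ω)_a = V^j ∂_j ω_a + ∑ᵣ (∂_{aᵣ} V^j) ω_{a[r↦j]}`. -/
def lieDF {n p : ℕ} (V : VF n) (ω : Tens n p) : Tens n p :=
  fun x a => fderiv ℝ (fun y => ω y a) x (V x)
    + ∑ r : Fin p, ∑ j, pd (a r) (fun y => V y j) x * ω x (Function.update a r j)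

/-- Lie derivative of a `p`-vector field along a vector field:
`(L_V T)^a = V^j ∂_j T^a − ∑ᵣ (∂_j V^{aᵣ}) T^{a[r↦j]}`. -/
def lieDV {n p : ℕ} (V : VF n) (T : Tens n p) : Tens n p :=
  fun x a => fderiv ℝ (fun y => T y a) x (V x)
    - ∑ r : Fin p, ∑ j, pd j (fun y => V y (a r)) x * T x (Function.update a r j)

/-- The map `Π^# : Ωᵖ(M) → 𝔛(M)` induced by a `(p+1)`-vector field `Π`, i.e.
`Π^#(ξ) = (−1)ᵖ i_ξ Π`; in components `Π^#(ξ)^i = ξ_K Π^{iK}` (sum over strictly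
ordered multi-indices `K`, hence the factor `1/p!` for the sum over all tuples). -/
def sharp {n p : ℕ} (P : Tens n (p + 1)) (ξ : Tens n p) : VF n :=
  fun x i => (p.factorial : ℝ)⁻¹ * ∑ K : Fin p → Fin n, ξ x K * P x (Fin.cons i K)

/-- Sections `V + ξ` of `E = TM ⊕ ΛᵖT*M`, with `p = q + 1`. -/
abbrev Sec (n q : ℕ) := VF n × Tens n (q + 1)

/-- `e = V + ξ` is a section of `E`: `V` a smooth vector field,
`ξ` a smooth `p`-form. -/
structure IsSec {n q : ℕ} (e : Sec n q) : Prop where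
  smoothV : ContDiff ℝ (⊤ : ℕ∞) e.1
  smoothF : SmoothT e.2
  altF : AltT e.2

/-- The pairing `⟨V+ξ, W+η⟩ = i_V η + i_W ξ ∈ Ω^{p−1}(M)`. -/
def pairD {n q : ℕ} (e₁ e₂ : Sec n q) : Tens n q :=
  iV e₁.1 e₂.2 + iV e₂.1 e₁.2

/-- The higher Dorfman bracket `[V+ξ, W+η]_D = [V,W] + L_V η − i_W dξ`. -/
def dorf {n q : ℕ} (e₁ e₂ : Sec n q) : Sec n q :=
  (lieB e₁.1 e₂.1, lieDF e₁.1 e₂.2 - iV e₂.1 (dT e₁.2))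

/-- The anchor map of the higher Roytenberg bracket: `ρ(V+ξ) = V − Π^#(ξ)`,
for a `(p+1)`-vector field `Π` (here `p = q + 1`). -/
def rhoR {n q : ℕ} (P : Tens n (q + 2)) (e : Sec n q) : VF n :=
  e.1 - sharp P e.2

/-- The twisted inclusion `j(ξ) = ξ + Π^#(ξ)`. -/
def jR {n q : ℕ} (P : Tens n (q + 2)) (ξ : Tens n (q + 1)) : Sec n q :=
  (sharp P ξ, ξ)

/-- The twisted pairing `⟨e₁,e₂⟩_R = i_{ρ(e₁)}(pr₂ e₂) + i_{ρ(e₂)}(pr₂ e₁)`. -/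
def pairR {n q : ℕ} (P : Tens n (q + 2)) (e₁ e₂ : Sec n q) : Tens n q :=
  iV (rhoR P e₁) e₂.2 + iV (rhoR P e₂) e₁.2

/-- The higher Roytenberg bracket, twisted by the `(p+1)`-vector `Π` and the
`(p+2)`-form `H`:
`[e₁,e₂]_R = [ρ(e₁),ρ(e₂)] + j(L_{ρ(e₁)}(pr₂ e₂) − i_{ρ(e₂)} d(pr₂ e₁) + i_{ρ(e₂)} i_{ρ(e₁)} H)`. -/
def royt {n q : ℕ} (P : Tens n (q + 2)) (H : Tens n (q + 3))
    (e₁ e₂ : Sec n q) : Sec n q :=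
  (lieB (rhoR P e₁) (rhoR P e₂), 0) +
    jR P (lieDF (rhoR P e₁) e₂.2 - iV (rhoR P e₂) (dT e₁.2)
      + iV (rhoR P e₂) (iV (rhoR P e₁) H))

/-- The coordinate vector field `∂ₖ`. -/
def coordVF {n : ℕ} (k : Fin n) : VF n := fun _ => Pi.single k 1

/-- The generalized Kronecker delta `δ^J_a` of two multi-indices. -/
def gdelta {n p : ℕ} (J a : Fin p → Fin n) : ℝ :=
  ∑ σ : Equiv.Perm (Fin p), ((Equiv.Perm.sign σ : ℤ) : ℝ) * (if a = J ∘ σ then 1 else 0)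

/-- The coordinate `p`-form `dy^J = dy^{j₁} ∧ ⋯ ∧ dy^{j_p}` (in components,
the generalized Kronecker delta). -/
def dyF {n p : ℕ} (J : Fin p → Fin n) : Tens n p := fun _ a => gdelta J a

/-- The section `∂ₖ + 0` of `E`. -/
def coordSec {n q : ℕ} (k : Fin n) : Sec n q := (coordVF k, 0)

/-- The section `0 + dy^J` of `E`. -/
def dySec {n q : ℕ} (J : Fin (q + 1) → Fin n) : Sec n q := (0, dyF J)

theorem aux_sharp_gdelta {n p : ℕ} (P : Tens n (p + 1)) (hPa : AltT P) (J : Fin p → Fin n)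
    (x : Pt n) (i : Fin n) :
    (p.factorial : ℝ)⁻¹ * ∑ K : Fin p → Fin n, gdelta J K * P x (Fin.cons i K)
      = P x (Fin.cons i J) := by
  have h : ∀ σ : Equiv.Perm (Fin p), ((Equiv.Perm.sign σ : ℤ) : ℝ) * P x (Fin.cons i (J ∘ σ))
      = P x (Fin.cons i J) := by
    intro σ
    have h1 : (Fin.cons i (J ∘ σ) : Fin (p+1) → Fin n)
        = (Fin.cons i J : Fin (p+1) → Fin n) ∘ (Equiv.Perm.decomposeFin.symm (0, σ)) := by
      funext s
      refine Fin.cases ?_ (fun s => ?_) s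
      · simp
      · simp
    have h2 := hPa x (Fin.cons i J) (Equiv.Perm.decomposeFin.symm (0, σ))
    rw [h1, h2, Equiv.Perm.decomposeFin.symm_sign]
    rcases Int.units_eq_one_or (Equiv.Perm.sign σ) with h | h <;> simp [h]
  have h3 : ∑ K : Fin p → Fin n, gdelta J K * P x (Fin.cons i K)
      = (p.factorial : ℝ) * P x (Fin.cons i J) := by
    unfold gdelta
    simp_rw [Finset.sum_mul]
    rw [Finset.sum_comm]
    have : ∀ σ : Equiv.Perm (Fin p), ∑ K : Fin p → Fin n,
        ((Equiv.Perm.sign σ : ℤ) : ℝ) * (if K = J ∘ σ then 1 else 0) * P x (Fin.cons i K)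
        = P x (Fin.cons i J) := by
      intro σ
      rw [← h σ, Finset.sum_eq_single (J ∘ σ)]
      · simp
      · intro b _ hb
        simp [hb]
      · simp
    rw [Finset.sum_congr rfl (fun σ _ => this σ)]
    simp [Fintype.card_perm]
  rw [h3]
  have : (p.factorial : ℝ) ≠ 0 := by exact_mod_cast p.factorial_ne_zero
  field_simp

theorem aux_gdelta {n p : ℕ} (A : Fin n → Fin n → ℝ) (J a : Fin p → Fin n) :
    ∑ r : Fin p, ∑ j, A (a r) j * gdelta J (Function.update a r j)
      = ∑ r : Fin p, ∑ k, A k (J r) * gdelta (Function.update J r k) a := by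
  have hL : ∀ r : Fin p, ∑ j, A (a r) j * gdelta J (Function.update a r j)
      = ∑ σ : Equiv.Perm (Fin p), ((Equiv.Perm.sign σ : ℤ) : ℝ) *
          (if ∀ s, s ≠ r → a s = J (σ s) then A (a r) (J (σ r)) else 0) := by
    intro r
    unfold gdelta
    simp_rw [Finset.mul_sum]
    rw [Finset.sum_comm]
    refine Finset.sum_congr rfl fun σ _ => ?_
    have e : ∀ j, (Function.update a r j = J ∘ σ) ↔
        (j = J (σ r) ∧ ∀ s, s ≠ r → a s = J (σ s)) := by
      intro j
      rw [Function.update_eq_iff]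
      rfl
    rw [Finset.sum_eq_single (J (σ r))]
    · simp only [e, true_and]
      split_ifs <;> ring
    · intro b _ hb
      simp [e, hb]
    · simp
  have hR : ∀ σ : Equiv.Perm (Fin p), ∀ r : Fin p,
      ∑ k, A k (J (σ r)) * (((Equiv.Perm.sign σ : ℤ) : ℝ) *
        (if a = Function.update J (σ r) k ∘ σ then 1 else 0))
      = ((Equiv.Perm.sign σ : ℤ) : ℝ) *
          (if ∀ s, s ≠ r → a s = J (σ s) then A (a r) (J (σ r)) else 0) := by
    intro σ r
    have e : ∀ k, (a = Function.update J (σ r) k ∘ σ) ↔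
        (a r = k ∧ ∀ s, s ≠ r → a s = J (σ s)) := by
      intro k
      rw [Function.update_comp_eq_of_injective _ σ.injective, Function.eq_update_iff]
      rfl
    rw [Finset.sum_eq_single (a r)]
    · simp only [e, true_and]
      split_ifs <;> ring
    · intro b _ hb
      simp [e, hb.symm]
    · simp
  rw [Finset.sum_congr rfl (fun r _ => hL r), Finset.sum_comm]
  simp_rw [← hR]
  unfold gdelta
  simp_rw [Finset.mul_sum]
  have : ∀ r : Fin p, ∑ k, ∑ σ : Equiv.Perm (Fin p), A k (J r) * (((Equiv.Perm.sign σ : ℤ) : ℝ) *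
        (if a = Function.update J r k ∘ σ then 1 else 0))
      = ∑ σ : Equiv.Perm (Fin p), ∑ k, A k (J r) * (((Equiv.Perm.sign σ : ℤ) : ℝ) *
        (if a = Function.update J r k ∘ σ then 1 else 0)) := fun r => Finset.sum_comm
  rw [Finset.sum_congr rfl (fun r _ => this r)]
  conv_rhs => rw [Finset.sum_comm]
  refine Finset.sum_congr rfl fun σ _ => ?_
  exact Equiv.sum_comp σ (fun r => ∑ k, A k (J r) * (((Equiv.Perm.sign σ : ℤ) : ℝ) *
        (if a = Function.update J r k ∘ σ then 1 else 0)))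

theorem aux_rho {n q : ℕ} (P : Tens n (q + 2)) (hPa : AltT P) (J : Fin (q + 1) → Fin n) :
    rhoR P (dySec J) = fun x i => - P x (Fin.cons i J) := by
  funext x i
  simp only [rhoR, dySec, sharp, dyF, Pi.sub_apply, Pi.zero_apply]
  rw [aux_sharp_gdelta P hPa, zero_sub]

theorem aux_pd_neg {n : ℕ} (k : Fin n) (f : Pt n → ℝ) (x : Pt n) :
    pd k (fun y => - f y) x = - pd k f x := by
  unfold pd
  rw [fderiv_fun_neg]
  rfl

theorem aux_form {n q : ℕ} (P : Tens n (q + 2)) (hPa : AltT P) (H : Tens n (q + 3))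
    (I J : Fin (q + 1) → Fin n) :
    (lieDF (rhoR P (dySec I)) (dySec J : Sec n q).2
      - iV (rhoR P (dySec J)) (dT (dySec I : Sec n q).2)
      + iV (rhoR P (dySec J)) (iV (rhoR P (dySec I)) H)) =
    fun x a =>
          - (∑ r : Fin (q + 1), ∑ k : Fin n,
              pd k (fun y => P y (Fin.cons (J r) I)) x
                * gdelta (Function.update J r k) a)
        + ∑ k : Fin n, ∑ l : Fin n,
            P x (Fin.cons k I) * P x (Fin.cons l J)
              * H x (Fin.cons k (Fin.cons l a)) := by
  have hd : dT (dySec I : Sec n q).2 = 0 := by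
    funext x a
    simp [dT, dySec, dyF, pd]
  rw [hd, aux_rho P hPa, aux_rho P hPa]
  funext x a
  simp only [Pi.add_apply, Pi.sub_apply, lieDF, iV, dySec, dyF, aux_pd_neg, Pi.zero_apply,
    mul_zero, Finset.sum_const_zero, sub_zero]
  congr 1
  · rw [← aux_gdelta (fun k j => pd k (fun y => P y (Fin.cons j I)) x)]
    simp [Finset.sum_neg_distrib]
  · rw [Finset.sum_comm]
    refine Finset.sum_congr rfl fun l _ => ?_
    rw [Finset.mul_sum]
    refine Finset.sum_congr rfl fun k _ => ?_
    ring

theorem aux_fderiv {n : ℕ} (F : Pt n → Pt n) (hF : Differentiable ℝ F) (x v : Pt n) (m : Fin n) :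
    fderiv ℝ F x v m = ∑ ν, v ν * pd ν (fun y => F y m) x := by
  have h1 : fderiv ℝ F x v m = fderiv ℝ (fun y => F y m) x v := by
    rw [fderiv_apply (hF x)]
    rfl
  rw [h1]
  conv_lhs => rw [pi_eq_sum_univ' v]
  simp [pd, map_sum]

/-- In local coordinates the higher Roytenberg bracket of two
coordinate `p`-forms is `[dy^I, dy^J]_R = R^{IJm} ∂ₘ + S^{IJ}{}_L dy^L`, with
`R^{IJm} = Π^{nI} ∂ₙ Π^{mJ} − Π^{nJ} ∂ₙ Π^{mI}
  − Σᵣ (∂ₖ Π^{jᵣI}) Π^{m j₁…k…j_p} + Π^{kI} Π^{lJ} Π^{mL} H_{klL}` and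
`S^{IJ}{}_L = −Σᵣ (∂ₖ Π^{jᵣI}) δ^{j₁…k…j_p}_L + Π^{kI} Π^{lJ} H_{klL}`,
where in the sums over `r` the index `k` replaces `jᵣ` in the multi-index
`J = (j₁,…,j_p)`.  (Sums over ordered multi-indices are written as sums over
all tuples divided by `p!`; the form `S^{IJ}{}_L dy^L` is recorded by its fully
antisymmetric component array; here `p = q + 1`.) -/
theorem higher_roytenberg_structure_functions_form_part {n q : ℕ}
    (P : Tens n (q + 2)) (hPs : SmoothT P) (hPa : AltT P)
    (H : Tens n (q + 3)) (hHs : SmoothT H) (hHa : AltT H) (hHcl : dT H = 0)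
    (I J : Fin (q + 1) → Fin n) (hI : StrictMono I) (hJ : StrictMono J) :
    royt P H (dySec I) (dySec J) =
      ((fun x m =>
          (∑ ν : Fin n, P x (Fin.cons ν I) * pd ν (fun y => P y (Fin.cons m J)) x)
        - (∑ ν : Fin n, P x (Fin.cons ν J) * pd ν (fun y => P y (Fin.cons m I)) x)
        - (∑ r : Fin (q + 1), ∑ k : Fin n,
            pd k (fun y => P y (Fin.cons (J r) I)) x
              * P x (Fin.cons m (Function.update J r k)))
        + ((q + 1).factorial : ℝ)⁻¹ *
            ∑ k : Fin n, ∑ l : Fin n, ∑ L : Fin (q + 1) → Fin n,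
              P x (Fin.cons k I) * P x (Fin.cons l J) * P x (Fin.cons m L)
                * H x (Fin.cons k (Fin.cons l L))),
        fun x a =>
          - (∑ r : Fin (q + 1), ∑ k : Fin n,
              pd k (fun y => P y (Fin.cons (J r) I)) x
                * gdelta (Function.update J r k) a)
        + ∑ k : Fin n, ∑ l : Fin n,
            P x (Fin.cons k I) * P x (Fin.cons l J)
              * H x (Fin.cons k (Fin.cons l a))) := by
  unfold royt
  rw [aux_form P hPa, aux_rho P hPa, aux_rho P hPa]
  have hdiff : ∀ K : Fin (q + 1) → Fin n,
      Differentiable ℝ (fun (x : Pt n) (i : Fin n) => - P x (Fin.cons i K)) := by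
    intro K
    rw [differentiable_pi]
    intro i
    exact ((hPs (Fin.cons i K)).differentiable (by simp)).neg
  refine Prod.ext ?_ ?_
  · funext x m
    simp only [jR, Prod.fst_add, Pi.add_apply, lieB, Pi.sub_apply]
    rw [aux_fderiv _ (hdiff J), aux_fderiv _ (hdiff I)]
    simp only [aux_pd_neg, neg_mul_neg]
    rw [sub_add (_ - _) _ _, sub_eq_add_neg (_ - _) (_ - _)]
    congr 1
    simp only [sharp, add_mul, Finset.sum_add_distrib, mul_add]
    rw [neg_sub, sub_eq_neg_add]
    congr 1
    · simp only [neg_mul, Finset.sum_neg_distrib, mul_neg, neg_inj]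
      simp_rw [← aux_sharp_gdelta P hPa (Function.update J _ _) x m, Finset.sum_mul, Finset.mul_sum]
      rw [Finset.sum_comm]
      refine Finset.sum_congr rfl fun r _ => ?_
      rw [Finset.sum_comm]
      refine Finset.sum_congr rfl fun k _ => ?_
      refine Finset.sum_congr rfl fun K _ => ?_
      ring
    · congr 1
      simp_rw [Finset.sum_mul]
      rw [Finset.sum_comm]
      refine Finset.sum_congr rfl fun r _ => ?_
      rw [Finset.sum_comm]
      refine Finset.sum_congr rfl fun k _ => ?_
      refine Finset.sum_congr rfl fun K _ => ?_
      ring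
  · simp [jR]
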